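/- Let H be an m×n real matrix with full column rank. A set S of row indices is an (algebraic) observability set if and only if S is a minimal element of the family {support(H·c) : c ∈ ℝⁿ, c ≠ 0}; that is, S = support(H·c) for some nonzero c, and there is no nonzero c' with support(H·c') strictly contained in S. (Algebraic core of Theorem 4: observability sets are exactly the minimal supports of stealthy data injection attacks) -/

import Mathlib

/-- The submatrix of `H` obtained by deleting the rows indexed by `S`. -/
def delRows {m n : ℕ} (H : Matrix (Fin m) (Fin n) ℝ) (S : Set (Fin m)) :
    Matrix {i : Fin m // i ∉ S} (Fin n) ℝ :=
  Matrix.of fun i j => H i.1 j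

/-- `S` is an (algebraic) observability set: `H^(−S)` has nontrivial kernel, while adding
back any single row `k ∈ S` yields a matrix with trivial kernel. -/
def IsObsSet {m n : ℕ} (H : Matrix (Fin m) (Fin n) ℝ) (S : Set (Fin m)) : Prop :=
  (∃ c : Fin n → ℝ, c ≠ 0 ∧ (delRows H S).mulVec c = 0) ∧
  (∀ k ∈ S, ∀ c : Fin n → ℝ, (delRows H (S \ {k})).mulVec c = 0 → c = 0)

theorem delRows_mulVec_eq_zero_iff {m n : ℕ} (H : Matrix (Fin m) (Fin n) ℝ) (S : Set (Fin m))
    (c : Fin n → ℝ) :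
    (delRows H S).mulVec c = 0 ↔ Function.support (H.mulVec c) ⊆ S := by
  rw [Function.support_subset_iff']
  exact ⟨fun h i hi => congrFun h ⟨i, hi⟩, fun h => funext fun i => h i.1 i.2⟩

/-- Algebraic core of Theorem 4: for `H` of full column rank, `S` is an observability set
if and only if `S` is a minimal element of the family of supports of nonzero stealthy
data injection attacks. -/
theorem observability_sets_are_minimal_supports
    {m n : ℕ} (H : Matrix (Fin m) (Fin n) ℝ) (hH : H.rank = n) (S : Set (Fin m)) :
    IsObsSet H S ↔
      ((∃ c : Fin n → ℝ, c ≠ 0 ∧ Function.support (H.mulVec c) = S) ∧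
       (∀ c' : Fin n → ℝ, c' ≠ 0 → ¬ Function.support (H.mulVec c') ⊂ S)) := by
  simp only [IsObsSet, delRows_mulVec_eq_zero_iff]
  constructor
  · rintro ⟨⟨c, hc, hcS⟩, hmin⟩
    have hnot : ∀ c' : Fin n → ℝ, c' ≠ 0 → ¬ Function.support (H.mulVec c') ⊂ S := by
      intro c' hc' hss
      obtain ⟨k, hkS, hk⟩ := Set.exists_of_ssubset hss
      exact hc' (hmin k hkS c' (Set.subset_sdiff_singleton hss.subset hk))
    exact ⟨⟨c, hc, hcS.eq_of_not_ssubset (hnot c hc)⟩, hnot⟩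
  · rintro ⟨⟨c, hc, hcS⟩, hnot⟩
    refine ⟨⟨c, hc, hcS.subset⟩, fun k hk c' hc' => ?_⟩
    by_contra hne
    exact hnot c' hne (hc'.trans_ssubset (Set.sdiff_singleton_ssubset.2 hk))
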